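/- Let X be a set, ⋆ and □ sup-compatible relations on the filters on X, and J a steady class of filters on X containing all principal filters. For any filter F on X the following are equivalent: (a) F ∈ J^{⋆□}; (b) for every G ∈ J^⋆ with G # F, F ∨ G ∈ J^{⋆⋆□}; (c) for every G ∈ J^⋆ with G # F, F ∨ G ∈ F_1^{⋆⋆□}; (d) for every G ∈ J^⋆ with G # F, F ∨ G ∈ J^□; (e) for every G ∈ J^⋆ with G # F, F ∨ G ∈ F_1^□. -/

import Mathlib

open Filter Set

variable {X : Type*}

/-- Two filters mesh if all their members intersect, i.e. the filter generated by
pairwise intersections (which is `F ⊓ G` in Mathlib's order) is proper. -/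
def Mesh (F G : Filter X) : Prop := Filter.NeBot (F ⊓ G)

/-- A relation on the filters on `X` is sup-compatible if it is symmetric, holds for
non-meshing pairs, and satisfies `F ⋆ (G ∨ H) → (F ∨ H) ⋆ G` when `G # F` and `F # H`
(the paper's `∨` of filters is Mathlib's `⊓`). -/
def SupCompatible (r : Filter X → Filter X → Prop) : Prop :=
  (∀ F G, r F G → r G F) ∧
  (∀ F G, ¬ Mesh F G → r F G) ∧
  (∀ F G H, Mesh G F → Mesh F H → r F (G ⊓ H) → r (F ⊓ H) G)

/-- The polar `J^⋆` of a class of filters. -/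
def polar (r : Filter X → Filter X → Prop) (J : Set (Filter X)) : Set (Filter X) :=
  {F | ∀ G ∈ J, r F G}

/-- `J` is `(D, M)`-steady. -/
def Steady (J D M : Set (Filter X)) : Prop :=
  ∀ F ∈ J, ∀ H ∈ D, Mesh F H → F ⊓ H ∈ M

/-- The class of principal filters on `X`. -/
def F1 : Set (Filter X) := {G | ∃ A : Set X, G = 𝓟 A}

theorem Mesh.mono {F G F' G' : Filter X} (h : Mesh F G) (hle : F ⊓ G ≤ F' ⊓ G') : Mesh F' G' :=
  Filter.NeBot.mono h hle

namespace SupCompatible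

variable {r : Filter X → Filter X → Prop}

theorem symm (hr : SupCompatible r) {F G : Filter X} (h : r F G) : r G F :=
  hr.1 F G h

theorem of_mesh_imp (hr : SupCompatible r) {F G : Filter X} (h : Mesh F G → r F G) : r F G :=
  (em (Mesh F G)).elim h (hr.2.1 F G)

/-- The exchange property holds without any meshing hypotheses. -/
theorem inf_left (hr : SupCompatible r) {F G H : Filter X} (h : r F (G ⊓ H)) : r (F ⊓ H) G :=
  hr.of_mesh_imp fun hm =>
    hr.2.2 F G H
      (hm.mono (le_inf inf_le_right (inf_le_left.trans inf_le_left)))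
      (hm.mono inf_le_left) h

end SupCompatible

theorem polar_anti (r : Filter X → Filter X → Prop) {J K : Set (Filter X)} (h : J ⊆ K) :
    polar r K ⊆ polar r J :=
  fun _ hF G hG => hF G (h hG)

theorem SupCompatible.subset_polar_polar {r : Filter X → Filter X → Prop} (hr : SupCompatible r)
    (J : Set (Filter X)) : J ⊆ polar r (polar r J) :=
  fun F hF _ hG => hr.symm (hG F hF)

/-- The polar of a steady class absorbs meets with members of that class. -/
theorem Steady.inf_mem_polar {r : Filter X → Filter X → Prop} (hr : SupCompatible r)
    {J : Set (Filter X)} (hJ : Steady J J J) {G H : Filter X} (hG : G ∈ polar r J) (hH : H ∈ J) :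
    G ⊓ H ∈ polar r J := fun K hK =>
  hr.of_mesh_imp fun hm => hr.inf_left <| hG _ <| hJ K hK H hH <|
    hm.mono (le_inf inf_le_right (inf_le_left.trans inf_le_right))

/-- The polar of a steady class absorbs meets with members of its bipolar. -/
theorem Steady.inf_mem_polar_of_mem_bipolar {r : Filter X → Filter X → Prop}
    (hr : SupCompatible r) {J : Set (Filter X)} (hJ : Steady J J J) {G H : Filter X}
    (hG : G ∈ polar r J) (hH : H ∈ polar r (polar r J)) : G ⊓ H ∈ polar r J := fun K hK => by
  rw [inf_comm G H]
  refine hr.inf_left (hH _ ?_)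
  rw [inf_comm K G]
  exact hJ.inf_mem_polar hr hG hK

theorem stmt4 (star square : Filter X → Filter X → Prop)
    (hstar : SupCompatible star) (hsquare : SupCompatible square)
    (J : Set (Filter X)) (hJ : Steady J J J) (hJ1 : F1 ⊆ J) (F : Filter X) :
    List.TFAE [
      -- (a) F ∈ J^{⋆□}
      F ∈ polar square (polar star J),
      -- (b) ∀ G ∈ J^⋆ meshing F, F ∨ G ∈ J^{⋆⋆□}
      ∀ G ∈ polar star J, Mesh G F → F ⊓ G ∈ polar square (polar star (polar star J)),
      -- (c) ∀ G ∈ J^⋆ meshing F, F ∨ G ∈ F_1^{⋆⋆□}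
      ∀ G ∈ polar star J, Mesh G F → F ⊓ G ∈ polar square (polar star (polar star F1)),
      -- (d) ∀ G ∈ J^⋆ meshing F, F ∨ G ∈ J^□
      ∀ G ∈ polar star J, Mesh G F → F ⊓ G ∈ polar square J,
      -- (e) ∀ G ∈ J^⋆ meshing F, F ∨ G ∈ F_1^□
      ∀ G ∈ polar star J, Mesh G F → F ⊓ G ∈ polar square F1] := by
  tfae_have 1 → 2 := fun hF G hG _ H hH => by
    refine hsquare.inf_left (hF _ ?_)
    rw [inf_comm H G]
    exact hJ.inf_mem_polar_of_mem_bipolar hstar hG hH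
  tfae_have 2 → 3 := fun h G hG hm =>
    polar_anti square (polar_anti star (polar_anti star hJ1)) (h G hG hm)
  tfae_have 2 → 4 := fun h G hG hm =>
    polar_anti square (hstar.subset_polar_polar J) (h G hG hm)
  tfae_have 3 → 5 := fun h G hG hm =>
    polar_anti square (hstar.subset_polar_polar F1) (h G hG hm)
  tfae_have 4 → 5 := fun h G hG hm => polar_anti square hJ1 (h G hG hm)
  tfae_have 5 → 1 := fun h G hG => hsquare.of_mesh_imp fun hm => by
    have htop : square (F ⊓ G) ⊤ :=
      h G hG (hm.mono (inf_comm F G).le) ⊤ ⟨univ, principal_univ.symm⟩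
    have := hsquare.inf_left (hsquare.symm htop)
    rw [top_inf_eq] at this
    exact hsquare.symm this
  tfae_finish
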